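/- arXiv:2201.11566 — 2 statements merged into one kernel-verified Lean document; each statement's English description precedes it below -/
import Mathlib

section
/- For every prime power q ≥ 3 and every infinite cardinal κ there exists a quasigroup (Q, *) with |Q| = κ such that for all distinct u, v ∈ Q the subquasigroup generated by {u, v} has exactly q elements, and every pair of distinct elements of Q lies in exactly one 2-generated subquasigroup; hence the 2-generated subquasigroups of (Q, *) form the blocks of a Steiner system with block size q on Q. -/
universe u

/-- `op` is a quasigroup operation: all left and right translations are
bijections. -/
def IsQuasigroup {Q : Type*} (op : Q → Q → Q) : Prop :=
  (∀ u v : Q, ∃! x : Q, op u x = v) ∧ (∀ u v : Q, ∃! y : Q, op y u = v)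

/-- The subquasigroup generated by a set `s`: the smallest subset containing
`s` and closed under the operation. -/
def genBy {Q : Type*} (op : Q → Q → Q) (s : Set Q) : Set Q :=
  ⋂₀ {T : Set Q | s ⊆ T ∧ ∀ x ∈ T, ∀ y ∈ T, op x y ∈ T}

section AffineLine

variable {F V : Type*} [Field F] [AddCommGroup V] [Module F V]

theorem isQuasigroup_lineMap {a : F} (h0 : a ≠ 0) (h1 : a ≠ 1) :
    IsQuasigroup (fun x y : V => AffineMap.lineMap x y a) := by
  have h1' : 1 - a ≠ 0 := sub_ne_zero.mpr h1.symm
  simp only [IsQuasigroup, AffineMap.lineMap_apply_module]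
  refine ⟨fun u v => ⟨a⁻¹ • (v - (1 - a) • u), ?_, fun y hy => ?_⟩,
    fun u v => ⟨(1 - a)⁻¹ • (v - a • u), ?_, fun y hy => ?_⟩⟩
  · simp [smul_inv_smul₀ h0]
  · rw [eq_inv_smul_iff₀ h0, ← hy, add_sub_cancel_left]
  · simp [smul_inv_smul₀ h1']
  · rw [eq_inv_smul_iff₀ h1', ← hy, add_sub_cancel_right]

/-- If `a` generates the multiplicative group of the field, then the closure of two points under
`x, y ↦ x + a • (y - x)` is the affine line through them. -/
theorem genBy_lineMap_eq_range {a : F} (ha : ∀ t : F, t ≠ 0 → ∃ k : ℕ, a ^ k = t) (u v : V) :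
    genBy (fun x y : V => AffineMap.lineMap x y a) {u, v} =
      Set.range (AffineMap.lineMap u v : F → V) := by
  apply Set.Subset.antisymm
  · refine Set.sInter_subset_of_mem ⟨?_, ?_⟩
    · rintro x (rfl | rfl)
      · exact ⟨0, AffineMap.lineMap_apply_zero _ _⟩
      · exact ⟨1, AffineMap.lineMap_apply_one _ _⟩
    · rintro _ ⟨s, rfl⟩ _ ⟨t, rfl⟩
      exact ⟨AffineMap.lineMap s t a, AffineMap.apply_lineMap _ _ _ _⟩
  · rintro _ ⟨t, rfl⟩ T ⟨hT, hcl⟩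
    have hu : u ∈ T := hT (by simp)
    rcases eq_or_ne t 0 with rfl | ht
    · simpa using hu
    obtain ⟨k, rfl⟩ := ha t ht
    clear ht
    induction k with
    | zero => simpa using hT (by simp : v ∈ ({u, v} : Set V))
    | succ k ih =>
      convert hcl _ hu _ ih using 1
      simp [AffineMap.lineMap_apply, smul_smul, pow_succ']

end AffineLine

theorem exists_forall_ne_zero_eq_pow (F : Type*) [Field F] [Finite F] :
    ∃ a : F, a ≠ 0 ∧ ∀ t : F, t ≠ 0 → ∃ k : ℕ, a ^ k = t := by
  obtain ⟨g, hg⟩ := IsCyclic.exists_monoid_generator (α := Fˣ)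
  refine ⟨g, g.ne_zero, fun t ht => ?_⟩
  obtain ⟨k, hk⟩ := Submonoid.mem_powers_iff _ _ |>.mp (hg (Units.mk0 t ht))
  exact ⟨k, by simpa using congrArg Units.val hk⟩

/-- For every prime power `q ≥ 3` and every infinite cardinal
`κ` there is a quasigroup of cardinality `κ` in which the subquasigroup
generated by any two distinct elements has exactly `q` elements and every
pair of distinct elements lies in exactly one 2-generated subquasigroup; so
its 2-generated subquasigroups form the blocks of a Steiner system with block
size `q`. -/
theorem exists_quasigroup_steiner (q : ℕ) (hq : IsPrimePow q) (h3 : 3 ≤ q)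
    (κ : Cardinal.{u}) (hκ : Cardinal.aleph0 ≤ κ) :
    ∃ (Q : Type u) (op : Q → Q → Q),
      Cardinal.mk Q = κ ∧ IsQuasigroup op ∧
      (∀ u v : Q, u ≠ v → (genBy op {u, v}).ncard = q) ∧
      (∀ x y : Q, x ≠ y → ∃! T : Set Q,
        (∃ u v : Q, u ≠ v ∧ T = genBy op {u, v}) ∧ x ∈ T ∧ y ∈ T) := by
  obtain ⟨p, n, hp, hn, rfl⟩ := hq
  have : Fact p.Prime := ⟨hp.nat_prime⟩
  let F := GaloisField p n
  have hF : Nat.card F = p ^ n := GaloisField.card p n hn.ne'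
  obtain ⟨a, h0, ha⟩ := exists_forall_ne_zero_eq_pow F
  have h1 : a ≠ 1 := by
    rintro rfl
    have hle : (Set.univ : Set F).ncard ≤ ({0, 1} : Set F).ncard :=
      Set.ncard_le_ncard fun t _ => by
        by_cases ht : t = 0
        · simp [ht]
        · obtain ⟨k, rfl⟩ := ha t ht
          simp
    rw [Set.ncard_univ, hF, Set.ncard_pair zero_ne_one] at hle
    omega
  have : Infinite κ.out := by rwa [Cardinal.infinite_iff, Cardinal.mk_out]
  let op : (κ.out →₀ F) → (κ.out →₀ F) → (κ.out →₀ F) := fun x y => AffineMap.lineMap x y a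
  have hgen (u v) : genBy op {u, v} = Set.range (AffineMap.lineMap u v : F → κ.out →₀ F) :=
    genBy_lineMap_eq_range ha u v
  have hcard (u v) (h : u ≠ v) : (genBy op {u, v}).ncard = p ^ n := by
    rw [hgen, ← Set.image_univ, Set.ncard_image_of_injective _ (AffineMap.lineMap_injective F h),
      Set.ncard_univ, hF]
  have hmem (u v) : u ∈ genBy op {u, v} ∧ v ∈ genBy op {u, v} :=
    ⟨fun T hT => hT.1 (by simp), fun T hT => hT.1 (by simp)⟩
  refine ⟨κ.out →₀ F, op, ?_, isQuasigroup_lineMap h0 h1, hcard, fun x y hxy =>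
    ⟨genBy op {x, y}, ⟨⟨x, y, hxy, rfl⟩, hmem x y⟩, ?_⟩⟩
  · rw [Cardinal.mk_finsupp_lift_of_infinite, Cardinal.mk_out, Cardinal.lift_uzero]
    exact max_eq_left ((Cardinal.lift_lt_aleph0.mpr (Cardinal.mk_lt_aleph0 (α := F))).le.trans hκ)
  · rintro _ ⟨⟨u, v, huv, rfl⟩, hx, hy⟩
    refine (Set.eq_of_subset_of_ncard_le (s := genBy op {x, y}) ?_ ?_ ?_).symm
    · rintro z hz T ⟨hT, hcl⟩
      exact hz T ⟨Set.pair_subset (hx T ⟨hT, hcl⟩) (hy T ⟨hT, hcl⟩), hcl⟩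
    · rw [hcard u v huv, hcard x y hxy]
    · rw [hgen]
      exact Set.finite_range _
end

section
/- For every prime power q ≥ 3 and every infinite cardinal κ there exists a Steiner system (M,B) with block size q and |M| = κ whose automorphism group acts 2-transitively on M: for any two pairs (a,b) and (a',b') of distinct points of M there is a bijection of M carrying blocks exactly to blocks that sends a to a' and b to b'. -/
universe u

/-- `Bl` is the family of blocks of a Steiner system with block size `q` on
`M`: each block has exactly `q` elements and each pair of distinct points
lies in exactly one block. -/
def IsSteinerSystem {M : Type*} (q : ℕ) (Bl : Set (Set M)) : Prop :=
  (∀ b ∈ Bl, b.ncard = q) ∧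
  ∀ x y : M, x ≠ y → ∃! b : Set M, b ∈ Bl ∧ x ∈ b ∧ y ∈ b

/-- The affine lines of an affine space, as sets of points. -/
def affineLines (F : Type*) {V P : Type*} [Ring F] [AddCommGroup V] [Module F V]
    [AddTorsor V P] : Set (Set P) :=
  {s | ∃ a b : P, a ≠ b ∧ s = Set.range (AffineMap.lineMap a b : F → P)}

section

variable {F V : Type*} [Field F] [AddCommGroup V] [Module F V]

theorem range_lineMap_eq_of_mem {a b x y : V} (hxy : x ≠ y)
    (hx : x ∈ Set.range (AffineMap.lineMap a b : F → V))
    (hy : y ∈ Set.range (AffineMap.lineMap a b : F → V)) :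
    Set.range (AffineMap.lineMap a b : F → V) = Set.range (AffineMap.lineMap x y : F → V) := by
  obtain ⟨r, rfl⟩ := hx
  obtain ⟨s, rfl⟩ := hy
  have hrs : s - r ≠ 0 := fun h => hxy (by rw [sub_eq_zero.mp h])
  ext z
  constructor
  · rintro ⟨t, rfl⟩
    refine ⟨(t - r) / (s - r), ?_⟩
    simp only [AffineMap.lineMap_apply_module]
    match_scalars <;> field_simp <;> ring
  · rintro ⟨t, rfl⟩
    refine ⟨r + t * (s - r), ?_⟩
    simp only [AffineMap.lineMap_apply_module]
    match_scalars <;> ring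

theorem isSteinerSystem_affineLines :
    IsSteinerSystem (Nat.card F) (affineLines F : Set (Set V)) := by
  constructor
  · rintro _ ⟨a, b, hab, rfl⟩
    rw [← Set.image_univ, Set.ncard_image_of_injective _ (AffineMap.lineMap_injective F hab),
      Set.ncard_univ]
  · intro x y hxy
    refine ⟨_, ⟨⟨x, y, hxy, rfl⟩, ⟨0, by simp⟩, ⟨1, by simp⟩⟩, ?_⟩
    rintro _ ⟨⟨a, b, -, rfl⟩, hx, hy⟩
    exact range_lineMap_eq_of_mem hxy hx hy

theorem AffineEquiv.image_mem_affineLines (e : V ≃ᵃ[F] V) {s : Set V} (hs : s ∈ affineLines F) :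
    e '' s ∈ affineLines F := by
  obtain ⟨a, b, hab, rfl⟩ := hs
  refine ⟨e a, e b, e.injective.ne hab, ?_⟩
  rw [← Set.range_comp]
  congr 1
  ext t
  exact e.apply_lineMap a b t

theorem AffineEquiv.image_mem_affineLines_iff (e : V ≃ᵃ[F] V) (s : Set V) :
    e '' s ∈ affineLines F ↔ s ∈ affineLines F := by
  refine ⟨fun h => ?_, e.image_mem_affineLines⟩
  have := e.symm.image_mem_affineLines h
  rwa [← Set.image_comp, show (e.symm ∘ e : V → V) = id from funext e.symm_apply_apply,
    Set.image_id] at this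

end

theorem exists_affineEquiv_apply_eq (F : Type*) {K : Type*} [Field F] [Field K] [Algebra F K]
    {a b a' b' : K} (hab : a ≠ b) (hab' : a' ≠ b') :
    ∃ e : K ≃ᵃ[F] K, e a = a' ∧ e b = b' := by
  have h : b - a ≠ 0 := sub_ne_zero.mpr hab.symm
  have h' : b' - a' ≠ 0 := sub_ne_zero.mpr hab'.symm
  let c : Kˣ := Units.mk0 ((b' - a') / (b - a)) (div_ne_zero h' h)
  let l : K ≃ₗ[F] K := LinearEquiv.smulOfUnit c |>.restrictScalars F
  have hl (x : K) : l x = (b' - a') / (b - a) * x := rfl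
  refine ⟨l.toAffineEquiv.trans (AffineEquiv.constVAdd F K (a' - l a)), ?_, ?_⟩
  · simp
  · simp [hl]
    field_simp
    ring

theorem exists_field_algebra_mk_eq (F : Type) [Field F] [Finite F] (κ : Cardinal.{u})
    (hκ : Cardinal.aleph0 ≤ κ) :
    ∃ (K : Type u) (_ : Field K) (_ : Algebra F K), Cardinal.mk K = κ := by
  have hne : Nonempty κ.out := Cardinal.mk_ne_zero_iff.mp <| by
    rw [Cardinal.mk_out]
    exact (Cardinal.aleph0_pos.trans_le hκ).ne'
  refine ⟨FractionRing (MvPolynomial κ.out F), inferInstance, inferInstance, ?_⟩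
  rw [Cardinal.mk_fractionRing, MvPolynomial.cardinalMk_eq_max_lift, Cardinal.mk_out]
  have : Cardinal.lift.{u} (Cardinal.mk F) ≤ κ :=
    (Cardinal.lift_le_aleph0.mpr Cardinal.mk_le_aleph0).trans hκ
  simp [this, hκ]

/-- For every prime power `q ≥ 3` and every infinite cardinal
`κ` there is a Steiner system with block size `q` of cardinality `κ` whose
automorphism group acts 2-transitively: any pair of distinct points can be
carried to any other pair of distinct points by a bijection of the point set
mapping blocks exactly to blocks. -/
theorem exists_two_transitive_steiner (q : ℕ) (hq : IsPrimePow q) (h3 : 3 ≤ q)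
    (κ : Cardinal.{u}) (hκ : Cardinal.aleph0 ≤ κ) :
    ∃ (M : Type u) (Bl : Set (Set M)),
      Cardinal.mk M = κ ∧ IsSteinerSystem q Bl ∧
      ∀ a b a' b' : M, a ≠ b → a' ≠ b' →
        ∃ e : M ≃ M, (∀ s : Set M, s ∈ Bl ↔ (e '' s) ∈ Bl) ∧
          e a = a' ∧ e b = b' := by
  obtain ⟨p, n, hp, hn, rfl⟩ := (isPrimePow_nat_iff q).mp hq
  have : Fact p.Prime := ⟨hp⟩
  obtain ⟨K, _, _, hK⟩ := exists_field_algebra_mk_eq (GaloisField p n) κ hκ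
  refine ⟨K, affineLines (GaloisField p n), hK, ?_, fun a b a' b' hab hab' => ?_⟩
  · rw [← GaloisField.card p n hn.ne']
    exact isSteinerSystem_affineLines
  · obtain ⟨e, ha, hb⟩ := exists_affineEquiv_apply_eq (GaloisField p n) hab hab'
    exact ⟨e.toEquiv, fun s => (e.image_mem_affineLines_iff s).symm, ha, hb⟩
end
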